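/- arXiv:2009.13760 — 5 statements merged into one kernel-verified Lean document; each statement's English description precedes it below -/
import Mathlib

section
/- Let n = k + ℓ and write points of ℝ^n = ℝ^k × ℝ^ℓ as (x, y). If f : ℝ^n → ℝ is smooth, compactly supported, and vanishes to infinite order on {0} × ℝ^ℓ, then there exist a smooth function ρ : ℝ^k → ℝ which vanishes to infinite order at the point 0 ∈ ℝ^k and satisfies ρ(x) > 0 for all x ≠ 0, and a smooth function h : ℝ^n → ℝ vanishing to infinite order on {0} × ℝ^ℓ, such that f(x, y) = ρ(x) h(x, y) for all (x, y) ∈ ℝ^n. -/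
open scoped ContDiff Topology

/-- smooth and flat on `{0} × Y` -/
def FlatOn {X Y F : Type} [NormedAddCommGroup X] [NormedSpace ℝ X] [NormedAddCommGroup Y]
    [NormedSpace ℝ Y] [NormedAddCommGroup F] [NormedSpace ℝ F] (f : X × Y → F) : Prop :=
  ContDiff ℝ ∞ f ∧ ∀ z : X × Y, z.1 = 0 → ∀ j : ℕ, iteratedFDeriv ℝ j f z = 0

section
variable {X Y : Type} [NormedAddCommGroup X] [NormedSpace ℝ X] [NormedAddCommGroup Y]
    [NormedSpace ℝ Y]

lemma FlatOn.der {F : Type} [NormedAddCommGroup F] [NormedSpace ℝ F] {f : X × Y → F}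
    (hf : FlatOn f) : FlatOn (fderiv ℝ f) := by
  refine ⟨hf.1.fderiv_right (by simp), fun z hz j => ?_⟩
  rw [← norm_eq_zero, norm_iteratedFDeriv_fderiv, hf.2 z hz, norm_zero]

lemma FlatOn.zero {F : Type} [NormedAddCommGroup F] [NormedSpace ℝ F] {f : X × Y → F}
    (hf : FlatOn f) {z : X × Y} (hz : z.1 = 0) : f z = 0 := by
  rw [← norm_eq_zero, ← norm_iteratedFDeriv_zero (𝕜 := ℝ), hf.2 z hz, norm_zero]

lemma FlatOn.smulRight {F : Type} [NormedAddCommGroup F] [NormedSpace ℝ F] {f : X × Y → F}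
    (hf : FlatOn f) {g : X × Y → (X × Y →L[ℝ] ℝ)} (hg : ContDiff ℝ ∞ g) :
    FlatOn (fun z => (g z).smulRight (f z)) := by
  refine ⟨hg.smulRight hf.1, fun z hz j => ?_⟩
  have h := (ContinuousLinearMap.smulRightL ℝ (X × Y) F).norm_iteratedFDeriv_le_of_bilinear
    hg hf.1 z (n := j) (by exact_mod_cast le_top)
  rw [← norm_eq_zero]
  refine le_antisymm (h.trans ?_) (norm_nonneg _)
  simp [hf.2 z hz]

lemma FlatOn.bound [ProperSpace X] [ProperSpace Y] (R : ℝ) (M : ℕ) :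
    ∀ {F : Type} [NormedAddCommGroup F] [NormedSpace ℝ F] {f : X × Y → F}, FlatOn f →
    ∃ C, 0 ≤ C ∧ ∀ z : X × Y, ‖z‖ ≤ R → ‖f z‖ ≤ C * ‖z.1‖ ^ M := by
  induction M with
  | zero =>
    intro F _ _ f hf
    obtain ⟨C, hC⟩ := (isCompact_closedBall (0 : X × Y) R).exists_bound_of_continuousOn
      hf.1.continuous.continuousOn
    refine ⟨max C 0, le_max_right _ _, fun z hz => ?_⟩
    simpa using Or.inl (hC z (by simpa using hz))
  | succ M ih =>
    intro F _ _ f hf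
    obtain ⟨C, hC0, hC⟩ := ih hf.der
    refine ⟨C, hC0, fun z hz => ?_⟩
    have hR : 0 ≤ R := (norm_nonneg _).trans hz
    let s : Set (X × Y) := Metric.closedBall 0 ‖z.1‖ ×ˢ Metric.closedBall 0 ‖z.2‖
    have hs : Convex ℝ s := (convex_closedBall _ _).prod (convex_closedBall _ _)
    have h := hs.norm_image_sub_le_of_norm_fderiv_le (𝕜 := ℝ) (f := f) (C := C * ‖z.1‖ ^ M)
      (x := (0, z.2)) (y := z)
      (fun x _ => (hf.1.differentiable (by simp)).differentiableAt)
      (fun x hx => by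
        have h1 : ‖x.1‖ ≤ ‖z.1‖ := by simpa using hx.1
        have h2 : ‖x.2‖ ≤ ‖z.2‖ := by simpa using hx.2
        have : ‖x‖ ≤ R := by
          rw [Prod.norm_def] at hz ⊢
          exact (max_le_max h1 h2).trans hz
        refine (hC x this).trans ?_
        gcongr) (by simp [s]) (by simp [s])
    rw [hf.zero (z := (0, z.2)) rfl, sub_zero] at h
    refine h.trans (le_of_eq ?_)
    have : z - (0, z.2) = (z.1, 0) := by ext <;> simp
    rw [this, pow_succ, mul_assoc]
    simp [Prod.norm_def]

lemma contDiff_dr {r : X → ℝ} (hr : ContDiff ℝ ∞ r) (N : ℕ) :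
    ContDiff ℝ ∞ (fun z : X × Y => (N : ℝ) • fderiv ℝ (fun z : X × Y => r z.1) z) := by
  have h1 : ContDiff ℝ ∞ (fun z : X × Y => r z.1) := hr.comp contDiff_fst
  have h2 : ContDiff ℝ ∞ (fderiv ℝ (fun z : X × Y => r z.1)) := h1.fderiv_right (by simp)
  exact h2.const_smul (N : ℝ)

lemma FlatOn.hasFDerivAt_div [ProperSpace X] [ProperSpace Y] {r : X → ℝ} (hr : ContDiff ℝ ∞ r)
    (hrb : ∀ x, ‖x‖ ^ 2 ≤ r x)
    {F : Type} [NormedAddCommGroup F] [NormedSpace ℝ F] {f : X × Y → F}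
    (hf : FlatOn f) (N : ℕ) (z : X × Y) :
    HasFDerivAt (fun z : X × Y => ((r z.1)⁻¹) ^ N • f z)
      (((r z.1)⁻¹) ^ N • fderiv ℝ f z - ((r z.1)⁻¹) ^ (N + 1) •
        ((N : ℝ) • fderiv ℝ (fun z : X × Y => r z.1) z).smulRight (f z)) z := by
  by_cases hz : z.1 = 0
  · rw [hf.zero hz, hf.der.zero hz]
    obtain ⟨C, hC0, hC⟩ := hf.bound (‖z‖ + 1) (2 * N + 2)
    have key : ∀ w : X × Y, ‖w‖ ≤ ‖z‖ + 1 → ‖((r w.1)⁻¹) ^ N • f w‖ ≤ C * ‖w - z‖ ^ 2 := by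
      intro w hw
      have h1 : ‖w.1‖ ≤ ‖w - z‖ := by
        have := norm_fst_le (w - z)
        simpa [hz] using this
      by_cases hw1 : w.1 = 0
      · rw [hf.zero hw1]; simp; positivity
      have hpos : 0 < ‖w.1‖ := norm_pos_iff.2 hw1
      have hrp : 0 < r w.1 := lt_of_lt_of_le (by positivity) (hrb w.1)
      rw [norm_smul, norm_pow, norm_inv, Real.norm_of_nonneg hrp.le, inv_pow]
      rw [inv_mul_le_iff₀ (by positivity)]
      calc ‖f w‖ ≤ C * ‖w.1‖ ^ (2 * N + 2) := hC w hw
        _ = (‖w.1‖ ^ 2) ^ N * (C * ‖w.1‖ ^ 2) := by ring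
        _ ≤ (r w.1) ^ N * (C * ‖w - z‖ ^ 2) := by
          gcongr
          exact hrb _
    have hO : (fun w : X × Y => ((r w.1)⁻¹) ^ N • f w) =O[𝓝 z] fun w => ‖w - z‖ ^ 2 := by
      refine Asymptotics.IsBigO.of_bound C ?_
      filter_upwards [Metric.closedBall_mem_nhds z one_pos] with w hw
      rw [norm_pow, norm_norm]
      apply key
      rw [mem_closedBall_iff_norm] at hw
      calc ‖w‖ = ‖z + (w - z)‖ := by simp
        _ ≤ _ := (norm_add_le _ _).trans (by gcongr)
    simpa using hO.hasFDerivAt one_lt_two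
  · have hpos : 0 < ‖z.1‖ := norm_pos_iff.2 hz
    have hrp : 0 < r z.1 := lt_of_lt_of_le (by positivity) (hrb z.1)
    have hR : HasFDerivAt (fun z : X × Y => r z.1) (fderiv ℝ (fun z : X × Y => r z.1) z) z :=
      ((hr.comp contDiff_fst).differentiable (by simp)).differentiableAt.hasFDerivAt
    have hg : HasDerivAt (fun t : ℝ => (t⁻¹) ^ N) (-(N * ((r z.1)⁻¹) ^ (N + 1))) (r z.1) := by
      have := (hasDerivAt_inv hrp.ne').pow N
      refine HasDerivAt.congr_deriv this ?_
      rcases N with _ | N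
      · simp
      · simp; field_simp; ring
    have hF := ((hf.1.differentiable (by simp)) z).hasFDerivAt
    have := (hg.comp_hasFDerivAt z hR).smul hF
    refine HasFDerivAt.congr_fderiv this ?_
    ext v <;> simp <;> module

lemma FlatOn.contDiff_div [ProperSpace X] [ProperSpace Y] {r : X → ℝ} (hr : ContDiff ℝ ∞ r)
    (hrb : ∀ x, ‖x‖ ^ 2 ≤ r x)
    (n : ℕ) : ∀ {F : Type} [NormedAddCommGroup F] [NormedSpace ℝ F]
    {f : X × Y → F}, FlatOn f → ∀ N : ℕ,
    ContDiff ℝ n (fun z : X × Y => ((r z.1)⁻¹) ^ N • f z) := by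
  induction n with
  | zero =>
    intro F _ _ f hf N
    refine contDiff_zero.2 (continuous_iff_continuousAt.2 fun z => ?_)
    exact (hf.hasFDerivAt_div hr hrb N z).continuousAt
  | succ n ih =>
    intro F _ _ f hf N
    push_cast
    refine contDiff_succ_iff_hasFDerivAt.2 ⟨_, ?_, hf.hasFDerivAt_div hr hrb N⟩
    exact (ih hf.der N).sub (ih (hf.smulRight (contDiff_dr hr N)) (N + 1))

lemma FlatOn.flat_div [ProperSpace X] [ProperSpace Y] {r : X → ℝ} (hr : ContDiff ℝ ∞ r)
    (hrb : ∀ x, ‖x‖ ^ 2 ≤ r x)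
    (n : ℕ) : ∀ {F : Type} [NormedAddCommGroup F] [NormedSpace ℝ F]
    {f : X × Y → F}, FlatOn f → ∀ N : ℕ, ∀ z : X × Y, z.1 = 0 →
    iteratedFDeriv ℝ n (fun z : X × Y => ((r z.1)⁻¹) ^ N • f z) z = 0 := by
  induction n with
  | zero =>
    intro F _ _ f hf N z hz
    rw [← norm_eq_zero, norm_iteratedFDeriv_zero, hf.zero hz]; simp
  | succ n ih =>
    intro F _ _ f hf N z hz
    have hfl := hf.smulRight (contDiff_dr hr N)
    have hd := funext fun z => (hf.hasFDerivAt_div hr hrb N z).fderiv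
    rw [← norm_eq_zero, ← norm_iteratedFDeriv_fderiv, hd,
      fun_iteratedFDeriv_sub_apply (hf.der.contDiff_div hr hrb n N).contDiffAt
        (hfl.contDiff_div hr hrb n (N + 1)).contDiffAt, ih hf.der N z hz,
        ih hfl (N + 1) z hz]
    simp

lemma FlatOn.div [ProperSpace X] [ProperSpace Y] {r : X → ℝ} (hr : ContDiff ℝ ∞ r)
    (hrb : ∀ x, ‖x‖ ^ 2 ≤ r x)
    {F : Type} [NormedAddCommGroup F] [NormedSpace ℝ F]
    {f : X × Y → F} (hf : FlatOn f) (N : ℕ) :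
    FlatOn (fun z : X × Y => ((r z.1)⁻¹) ^ N • f z) :=
  ⟨contDiff_infty.2 fun n => hf.contDiff_div hr hrb n N,
    fun z hz j => hf.flat_div hr hrb j N z hz⟩

end
open scoped ContDiff Topology Nat

/-- exponential-type series -/
noncomputable def expSer (b : ℕ → ℝ) (s : ℝ) : ℝ := ∑' N : ℕ, b N * (s ^ N / N !)

lemma expSer_summable {b : ℕ → ℝ} (hb : ∀ n, |b n| ≤ 1) (s : ℝ) :
    Summable fun N : ℕ => b N * (s ^ N / N !) := by
  refine Summable.of_norm_bounded (Real.summable_pow_div_factorial |s|) fun N => ?_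
  rw [norm_mul, norm_div, norm_pow, Real.norm_eq_abs, Real.norm_eq_abs]
  have : ‖((N ! : ℕ) : ℝ)‖ = N ! := by simp
  rw [this]
  exact mul_le_of_le_one_left (by positivity) (hb N)

lemma expSer_hasDerivAt {b : ℕ → ℝ} (hb : ∀ n, |b n| ≤ 1) (s : ℝ) :
    HasDerivAt (expSer b) (expSer (fun n => b (n + 1)) s) s := by
  let g : ℕ → ℝ → ℝ := fun N y => b N * (y ^ N / N !)
  let g' : ℕ → ℝ → ℝ := fun N y => b N * (N * y ^ (N - 1) / N !)
  let u : ℕ → ℝ := fun N => N * (|s| + 1) ^ (N - 1) / (N ! : ℝ)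
  have hfac : ∀ (N : ℕ) (y : ℝ), ((N + 1 : ℕ) : ℝ) * y ^ N / (N + 1) ! = y ^ N / N ! := by
    intro N y
    rw [Nat.factorial_succ]; push_cast; field_simp
  have hu : Summable u := by
    rw [← summable_nat_add_iff 1]
    refine (Real.summable_pow_div_factorial (|s| + 1)).congr fun N => ?_
    simp only [u, Nat.add_sub_cancel]
    rw [hfac]
  have hg : ∀ n y, y ∈ Metric.ball (0 : ℝ) (|s| + 1) → HasDerivAt (g n) (g' n y) y := by
    intro n y _
    exact ((hasDerivAt_pow n y).div_const _).const_mul _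
  have hg' : ∀ n y, y ∈ Metric.ball (0 : ℝ) (|s| + 1) → ‖g' n y‖ ≤ u n := by
    intro n y hy
    have hy' : |y| ≤ |s| + 1 := by
      have := (mem_ball_zero_iff.1 hy).le
      simpa using this
    simp only [g', u, norm_mul, norm_div, norm_pow, Real.norm_eq_abs, Nat.abs_cast]
    calc _ ≤ 1 * (n * |y| ^ (n - 1) / n !) := by gcongr; exact hb n
      _ ≤ _ := by rw [one_mul]; gcongr
  have hmem : s ∈ Metric.ball (0 : ℝ) (|s| + 1) := by simp
  have h := hasDerivAt_tsum_of_isPreconnected hu Metric.isOpen_ball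
    (convex_ball _ _).isPreconnected hg hg' hmem (expSer_summable hb s) hmem
  refine HasDerivAt.congr_deriv h ?_
  have hs : Summable fun n => g' n s := Summable.of_norm_bounded hu fun n => hg' n s hmem
  rw [hs.tsum_eq_zero_add]
  simp only [g', expSer]
  simp only [Nat.cast_zero, zero_mul, zero_div, mul_zero, zero_add, Nat.add_sub_cancel, hfac]

lemma expSer_iteratedDeriv {b : ℕ → ℝ} (hb : ∀ n, |b n| ≤ 1) (i : ℕ) :
    iteratedDeriv i (expSer b) = expSer (fun n => b (n + i)) := by
  induction i with
  | zero => simp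
  | succ i ih =>
    rw [iteratedDeriv_succ, ih]
    funext s
    rw [(expSer_hasDerivAt (b := fun n => b (n + i)) (fun n => hb _) s).deriv]
    congr 1
    funext n
    congr 1
    ring

lemma expSer_contDiff {b : ℕ → ℝ} (hb : ∀ n, |b n| ≤ 1) : ContDiff ℝ ∞ (expSer b) := by
  refine contDiff_of_differentiable_iteratedDeriv fun m _ => ?_
  rw [expSer_iteratedDeriv hb]
  exact fun s => (expSer_hasDerivAt (b := fun n => b (n + m)) (fun n => hb _) s).differentiableAt

lemma expSer_ge {b : ℕ → ℝ} (hb : ∀ n, |b n| ≤ 1) (hpos : ∀ n, 0 < b n)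
    (M : ℕ) {s : ℝ} (hs : 0 ≤ s) : b M * (s ^ M / M !) ≤ expSer b s :=
  (expSer_summable hb s).le_tsum M fun j _ => by have := hpos j; positivity

lemma expSer_pos {b : ℕ → ℝ} (hb : ∀ n, |b n| ≤ 1) (hpos : ∀ n, 0 < b n)
    {s : ℝ} (hs : 0 ≤ s) : 0 < expSer b s :=
  lt_of_lt_of_le (by simpa using hpos 0) (expSer_ge hb hpos 0 hs)

lemma expSer_deriv_bound {b : ℕ → ℝ} (hb : ∀ n, |b n| ≤ 1) (hpos : ∀ n, 0 < b n)
    (hanti : Antitone b) (i : ℕ) {s : ℝ} (hs : 0 ≤ s) :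
    |iteratedDeriv i (expSer b) s| ≤ expSer b s := by
  rw [expSer_iteratedDeriv hb,
    abs_of_pos (expSer_pos (b := fun n => b (n + i)) (fun n => hb _) (fun n => hpos _) hs)]
  refine (expSer_summable (b := fun n => b (n + i)) (fun n => hb _) s).tsum_le_tsum (fun n => ?_)
    (expSer_summable hb s)
  have := hanti (Nat.le_add_right n i)
  dsimp only
  gcongr

lemma expSer_inv_bound {b : ℕ → ℝ} (hb : ∀ n, |b n| ≤ 1) (hpos : ∀ n, 0 < b n)
    (hanti : Antitone b) (n : ℕ) : ∃ C, 0 ≤ C ∧ ∀ s, 0 < s →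
    |iteratedDeriv n (expSer b)⁻¹ s| ≤ C * (expSer b s)⁻¹ := by
  induction n using Nat.strong_induction_on with
  | _ n ih =>
  rcases Nat.eq_zero_or_pos n with rfl | hn
  · refine ⟨1, zero_le_one, fun s hs => ?_⟩
    have := expSer_pos hb hpos hs.le
    simp [abs_of_pos this]
  choose! C hC0 hC using ih
  refine ⟨∑ i ∈ Finset.range n, (n.choose (i + 1) : ℝ) * C (n - (i + 1)),
    Finset.sum_nonneg fun i hi => mul_nonneg (by positivity)
      (hC0 _ (by have := Finset.mem_range.1 hi; omega)), fun s hs => ?_⟩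
  have hE := expSer_pos hb hpos hs.le
  have hEs : ContDiffAt ℝ n (expSer b) s :=
    ((expSer_contDiff hb).of_le (by exact_mod_cast le_top)).contDiffAt
  have hG : ContDiffAt ℝ n (expSer b)⁻¹ s := hEs.inv hE.ne'
  have h1 := iteratedDeriv_mul hEs hG
  have h2 : iteratedDeriv n (expSer b * (expSer b)⁻¹) s = 0 := by
    have : (expSer b * (expSer b)⁻¹) =ᶠ[𝓝 s] fun _ => (1 : ℝ) := by
      filter_upwards [lt_mem_nhds hs] with t ht
      exact mul_inv_cancel₀ (expSer_pos hb hpos (le_of_lt ht)).ne'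
    rw [this.iteratedDeriv_eq, iteratedDeriv_const]
    simp [hn.ne']
  rw [h2, Finset.sum_range_succ'] at h1
  simp only [Nat.choose_zero_right, Nat.cast_one, one_mul, iteratedDeriv_zero, Nat.sub_zero] at h1
  have h3 : expSer b s * |iteratedDeriv n (expSer b)⁻¹ s| ≤
      ∑ i ∈ Finset.range n, (n.choose (i + 1) : ℝ) * C (n - (i + 1)) := by
    nth_rewrite 1 [← abs_of_pos hE]
    rw [← abs_mul]
    have : expSer b s * iteratedDeriv n (expSer b)⁻¹ s = - ∑ i ∈ Finset.range n,
      (n.choose (i + 1) : ℝ) * iteratedDeriv (i + 1) (expSer b) s *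
        iteratedDeriv (n - (i + 1)) (expSer b)⁻¹ s := by linarith
    rw [this, abs_neg]
    refine (Finset.abs_sum_le_sum_abs _ _).trans (Finset.sum_le_sum fun i hi => ?_)
    have hi' : n - (i + 1) < n := by have := Finset.mem_range.1 hi; omega
    rw [abs_mul, abs_mul, Nat.abs_cast, mul_assoc]
    refine mul_le_mul_of_nonneg_left ?_ (by positivity)
    calc _ ≤ expSer b s * (C (n - (i + 1)) * (expSer b s)⁻¹) :=
          mul_le_mul (expSer_deriv_bound hb hpos hanti _ hs.le) (hC _ hi' s hs) (abs_nonneg _) hE.le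
      _ = _ := by field_simp
  rw [← div_eq_mul_inv, le_div_iff₀ hE, mul_comm]
  exact h3

lemma expSer_inv_decay {b : ℕ → ℝ} (hb : ∀ n, |b n| ≤ 1) (hpos : ∀ n, 0 < b n)
    (hanti : Antitone b) (n M : ℕ) : ∃ C, 0 ≤ C ∧ ∀ s, 0 < s →
    |s ^ M * iteratedDeriv n (expSer b)⁻¹ s| ≤ C := by
  obtain ⟨C, hC0, hC⟩ := expSer_inv_bound hb hpos hanti n
  have hbM := hpos M
  refine ⟨C * (M ! / b M), by positivity, fun s hs => ?_⟩
  have hE := expSer_pos hb hpos hs.le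
  have h1 := expSer_ge hb hpos M hs.le
  rw [abs_mul, abs_of_pos (pow_pos hs M)]
  calc _ ≤ s ^ M * (C * (expSer b s)⁻¹) := by gcongr; exact hC s hs
    _ = C * (s ^ M / expSer b s) := by ring
    _ ≤ _ := by
      refine mul_le_mul_of_nonneg_left ?_ hC0
      rw [div_le_div_iff₀ hE hbM]
      have : b M * (s ^ M / M !) * M ! ≤ expSer b s * M ! := by gcongr
      field_simp at this
      linarith

/-- the glued functions -/
noncomputable def glue (H : ℕ → ℝ → ℝ) (M n : ℕ) (t : ℝ) : ℝ :=
  if 0 < t then (t⁻¹) ^ M * H n t⁻¹ else 0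

lemma glue_hasDerivAt {H : ℕ → ℝ → ℝ} (hH : ∀ n s, 0 < s → HasDerivAt (H n) (H (n + 1) s) s)
    (hd : ∀ n M : ℕ, ∃ C, 0 ≤ C ∧ ∀ s, 0 < s → |s ^ M * H n s| ≤ C)
    (M n : ℕ) (t : ℝ) :
    HasDerivAt (glue H M n) (-M * glue H (M + 1) n t - glue H (M + 2) (n + 1) t) t := by
  rcases lt_trichotomy t 0 with ht | rfl | ht
  · have : glue H M n =ᶠ[𝓝 t] fun _ => (0 : ℝ) := by
      filter_upwards [gt_mem_nhds ht] with s hs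
      simp [glue, not_lt.2 (le_of_lt hs)]
    refine HasDerivAt.congr_of_eventuallyEq ?_ this
    simpa [glue, not_lt.2 ht.le] using hasDerivAt_const t (0 : ℝ)
  · obtain ⟨C, hC0, hC⟩ := hd n (M + 2)
    have hO : glue H M n =O[𝓝 0] fun w => ‖w - 0‖ ^ 2 := by
      refine Asymptotics.IsBigO.of_bound C (Filter.Eventually.of_forall fun w => ?_)
      simp only [glue, sub_zero, norm_pow, Real.norm_eq_abs]
      split_ifs with hw
      · have := hC w⁻¹ (inv_pos.2 hw)
        rw [abs_mul] at this ⊢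
        rw [abs_of_pos (by positivity)] at this ⊢
        rw [abs_abs, abs_of_pos hw]
        calc _ = w⁻¹ ^ M * (w⁻¹ * w) ^ 2 * |H n w⁻¹| := by rw [inv_mul_cancel₀ hw.ne']; simp
          _ = (w⁻¹ ^ (M + 2) * |H n w⁻¹|) * w ^ 2 := by ring
          _ ≤ _ := by gcongr
      · simp; positivity
    have := (hO.hasFDerivAt one_lt_two).hasDerivAt
    simpa [glue] using this
  · have : glue H M n =ᶠ[𝓝 t] fun t => (t⁻¹) ^ M * H n t⁻¹ := by
      filter_upwards [lt_mem_nhds ht] with s hs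
      simp [glue, hs]
    refine HasDerivAt.congr_of_eventuallyEq ?_ this
    have hi := hasDerivAt_inv ht.ne'
    have h := (hi.pow M).mul ((hH n t⁻¹ (inv_pos.2 ht)).comp t hi)
    refine HasDerivAt.congr_deriv h ?_
    simp only [glue, ht, if_true]
    rcases M with _ | M
    · simp; field_simp
    · simp; field_simp; ring

lemma glue_contDiff {H : ℕ → ℝ → ℝ} (hH : ∀ n s, 0 < s → HasDerivAt (H n) (H (n + 1) s) s)
    (hd : ∀ n M : ℕ, ∃ C, 0 ≤ C ∧ ∀ s, 0 < s → |s ^ M * H n s| ≤ C)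
    (m : ℕ) : ∀ M n, ContDiff ℝ m (glue H M n) := by
  induction m with
  | zero => exact fun M n => contDiff_zero.2 (continuous_iff_continuousAt.2 fun t =>
      (glue_hasDerivAt hH hd M n t).continuousAt)
  | succ m ih =>
    intro M n
    push_cast
    refine contDiff_succ_iff_deriv.2 ⟨fun t => (glue_hasDerivAt hH hd M n t).differentiableAt,
      by simp, ?_⟩
    rw [funext fun t => (glue_hasDerivAt hH hd M n t).deriv]
    exact (contDiff_const.mul (ih _ _)).sub (ih _ _)

lemma glue_flat {H : ℕ → ℝ → ℝ} (hH : ∀ n s, 0 < s → HasDerivAt (H n) (H (n + 1) s) s)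
    (hd : ∀ n M : ℕ, ∃ C, 0 ≤ C ∧ ∀ s, 0 < s → |s ^ M * H n s| ≤ C)
    (j : ℕ) : iteratedFDeriv ℝ j (glue H 0 0) 0 = 0 := by
  have hc : Continuous (iteratedFDeriv ℝ j (glue H 0 0)) :=
    (glue_contDiff hH hd j 0 0).continuous_iteratedFDeriv le_rfl
  have hz : Set.EqOn (iteratedFDeriv ℝ j (glue H 0 0)) (fun _ => 0) (Set.Iio 0) := by
    intro t ht
    have : glue H 0 0 =ᶠ[𝓝 t] fun _ => (0 : ℝ) := by
      filter_upwards [gt_mem_nhds ht] with s hs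
      simp [glue, not_lt.2 (le_of_lt hs)]
    have h2 := Filter.EventuallyEq.iteratedFDeriv ℝ this j
    rw [h2.eq_of_nhds]
    simp
  have := hz.closure hc continuous_const
  rw [closure_Iio] at this
  exact this (Set.mem_Iic.2 le_rfl)

set_option maxHeartbeats 1000000 in
theorem stmt11 (k l : ℕ) (f : (Fin k → ℝ) × (Fin l → ℝ) → ℝ)
    (hf : ContDiff ℝ (⊤ : ℕ∞) f) (hsupp : HasCompactSupport f)
    (hvan : ∀ z : (Fin k → ℝ) × (Fin l → ℝ), z.1 = 0 → ∀ j : ℕ, iteratedFDeriv ℝ j f z = 0) :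
    ∃ (ρ : (Fin k → ℝ) → ℝ) (h : (Fin k → ℝ) × (Fin l → ℝ) → ℝ),
      ContDiff ℝ (⊤ : ℕ∞) ρ ∧
      (∀ j : ℕ, iteratedFDeriv ℝ j ρ 0 = 0) ∧
      (∀ x : Fin k → ℝ, x ≠ 0 → 0 < ρ x) ∧
      ContDiff ℝ (⊤ : ℕ∞) h ∧
      (∀ z : (Fin k → ℝ) × (Fin l → ℝ), z.1 = 0 → ∀ j : ℕ, iteratedFDeriv ℝ j h z = 0) ∧
      ∀ z : (Fin k → ℝ) × (Fin l → ℝ), f z = ρ z.1 * h z := by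
  let r : (Fin k → ℝ) → ℝ := fun x => ∑ i, x i ^ 2
  have hr : ContDiff ℝ ∞ r := ContDiff.sum fun i _ => (contDiff_apply ℝ ℝ i).pow 2
  have hr0 : r 0 = 0 := by simp [r]
  have hrb : ∀ x, ‖x‖ ^ 2 ≤ r x := by
    intro x
    have hnn : 0 ≤ r x := Finset.sum_nonneg fun i _ => sq_nonneg _
    rw [← Real.le_sqrt (norm_nonneg _) hnn]
    refine (pi_norm_le_iff_of_nonneg (Real.sqrt_nonneg _)).2 fun i => ?_
    rw [Real.le_sqrt (norm_nonneg _) hnn, Real.norm_eq_abs, sq_abs]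
    exact Finset.single_le_sum (f := fun i => x i ^ 2) (fun i _ => sq_nonneg _) (Finset.mem_univ i)
  have hrpos : ∀ x, x ≠ 0 → 0 < r x := fun x hx =>
    lt_of_lt_of_le (pow_pos (norm_pos_iff.2 hx) 2) (hrb x)
  have hflat : FlatOn f := ⟨hf, hvan⟩
  let q : ℕ → (Fin k → ℝ) × (Fin l → ℝ) → ℝ := fun N z => ((r z.1)⁻¹) ^ N • f z
  have hq : ∀ N, FlatOn (q N) := fun N => hflat.div hr hrb N
  have hqs : ∀ N, HasCompactSupport (q N) := fun N =>
    hsupp.mono fun z hz hfz => hz (by simp only [q, hfz, smul_zero])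
  have hB : ∀ N j : ℕ, ∃ C, 0 ≤ C ∧ ∀ z, ‖iteratedFDeriv ℝ j (q N) z‖ ≤ C := by
    intro N j
    obtain ⟨C, hC⟩ := ((hqs N).iteratedFDeriv (𝕜 := ℝ) j).exists_bound_of_continuous
      ((hq N).1.continuous_iteratedFDeriv (by exact_mod_cast le_top))
    exact ⟨C, (norm_nonneg _).trans (hC 0), hC⟩
  choose B hB0 hB using hB
  let d : ℕ → ℝ := fun N => (1 / 2) ^ N / (1 + ∑ j ∈ Finset.range (N + 1), B N j)
  have hS : ∀ N, 0 ≤ ∑ j ∈ Finset.range (N + 1), B N j := fun N =>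
    Finset.sum_nonneg fun j _ => hB0 N j
  have hd0 : ∀ N, 0 < d N := fun N => by have := hS N; positivity
  have hd1 : ∀ N, d N ≤ 1 := fun N => by
    have := hS N
    refine div_le_one_of_le₀ ?_ (by positivity)
    have : ((1 : ℝ) / 2) ^ N ≤ 1 := pow_le_one₀ (by norm_num) (by norm_num)
    linarith
  have hdB : ∀ N j, j ≤ N → d N * B N j ≤ (1 / 2) ^ N := fun N j hj => by
    have h1 := hS N
    have h2 : B N j ≤ ∑ j ∈ Finset.range (N + 1), B N j :=
      Finset.single_le_sum (fun i _ => hB0 N i) (Finset.mem_range.2 (by omega))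
    rw [div_mul_eq_mul_div, div_le_iff₀ (by positivity)]
    gcongr
    linarith
  let b : ℕ → ℝ := fun N => ∏ i ∈ Finset.range (N + 1), d i
  have hbpos : ∀ N, 0 < b N := fun N => Finset.prod_pos fun i _ => hd0 i
  have hb1 : ∀ N, |b N| ≤ 1 := fun N => by
    rw [abs_of_pos (hbpos N)]
    exact Finset.prod_le_one (fun i _ => (hd0 i).le) fun i _ => hd1 i
  have hanti : Antitone b := antitone_nat_of_succ_le fun N => by
    simp only [b]
    rw [Finset.prod_range_succ _ (N + 1)]
    exact mul_le_of_le_one_right (hbpos N).le (hd1 _)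
  have hbd : ∀ N, b N ≤ d N := fun N => by
    simp only [b]
    rw [Finset.prod_range_succ]
    exact mul_le_of_le_one_left (hd0 N).le
      (Finset.prod_le_one (fun i _ => (hd0 i).le) fun i _ => hd1 i)
  let a : ℕ → ℝ := fun N => b N / (N.factorial : ℝ)
  have ha0 : ∀ N, 0 ≤ a N := fun N => by have := hbpos N; positivity
  have had : ∀ N, a N ≤ d N := fun N =>
    (div_le_self (hbpos N).le (by exact_mod_cast Nat.factorial_pos N)).trans (hbd N)
  -- the function h
  let u : ℕ → (Fin k → ℝ) × (Fin l → ℝ) → ℝ := fun N z => a N • q N z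
  let v : ℕ → ℕ → ℝ := fun j N => a N * B N j
  have hu : ∀ N, ContDiff ℝ (⊤ : ℕ∞) (u N) := fun N => (hq N).1.const_smul (a N)
  have hueq : ∀ j N z, iteratedFDeriv ℝ j (u N) z = a N • iteratedFDeriv ℝ j (q N) z :=
    fun j N z => iteratedFDeriv_const_smul_apply'
      ((hq N).1.of_le (by exact_mod_cast le_top)).contDiffAt
  have hv : ∀ j : ℕ, (j : ℕ∞) ≤ (⊤ : ℕ∞) → Summable (v j) := fun j _ => by
    refine Summable.of_norm_bounded_eventually_nat (g := fun N => (1 / 2 : ℝ) ^ N)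
      summable_geometric_two ?_
    filter_upwards [Filter.eventually_ge_atTop j] with N hN
    rw [Real.norm_of_nonneg (mul_nonneg (ha0 N) (hB0 N j))]
    exact (mul_le_mul_of_nonneg_right (had N) (hB0 N j)).trans (hdB N j hN)
  have huv : ∀ (j N : ℕ) (z), (j : ℕ∞) ≤ (⊤ : ℕ∞) → ‖iteratedFDeriv ℝ j (u N) z‖ ≤ v j N := by
    intro j N z _
    rw [hueq, norm_smul, Real.norm_of_nonneg (ha0 N)]
    exact mul_le_mul_of_nonneg_left (hB N j z) (ha0 N)
  -- the function ρ
  let H : ℕ → ℝ → ℝ := fun n => iteratedDeriv n (expSer b)⁻¹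
  have hH : ∀ n s, 0 < s → HasDerivAt (H n) (H (n + 1) s) s := by
    intro n s hs
    have hc : ContDiffAt ℝ ∞ (expSer b)⁻¹ s :=
      (expSer_contDiff hb1).contDiffAt.inv (expSer_pos hb1 hbpos hs.le).ne'
    have : DifferentiableAt ℝ (iteratedDeriv n (expSer b)⁻¹) s := by
      rw [iteratedDeriv_eq_equiv_comp]
      exact (LinearIsometryEquiv.differentiable _).differentiableAt.comp s
        (hc.differentiableAt_iteratedFDeriv (by exact_mod_cast WithTop.coe_lt_top n))
    simp only [H]
    rw [iteratedDeriv_succ]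
    exact this.hasDerivAt
  have hdec : ∀ n M : ℕ, ∃ C, 0 ≤ C ∧ ∀ s, 0 < s → |s ^ M * H n s| ≤ C :=
    fun n M => expSer_inv_decay hb1 hbpos hanti n M
  have hφ : ContDiff ℝ ∞ (glue H 0 0) := contDiff_infty.2 fun n => glue_contDiff hH hdec n 0 0
  have hφval : ∀ t, 0 < t → glue H 0 0 t = (expSer b t⁻¹)⁻¹ := fun t ht => by
    simp [glue, ht, H]
  refine ⟨glue H 0 0 ∘ r, fun z => ∑' N, u N z, hφ.comp hr, fun j => ?_, fun x hx => ?_,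
    contDiff_tsum hu hv huv, fun z hz j => ?_, fun z => ?_⟩
  · let D : ℝ := 1 + ∑ i ∈ Finset.range (j + 1), ‖iteratedFDeriv ℝ i r 0‖
    have hD1 : 1 ≤ D := le_add_of_nonneg_right (Finset.sum_nonneg fun i _ => norm_nonneg _)
    have h := norm_iteratedFDeriv_comp_le hφ hr (n := j) (by exact_mod_cast le_top) 0
      (C := 0) (D := D) (fun i _ => by rw [hr0, glue_flat hH hdec, norm_zero])
      (fun i hi1 hi => by
        have h2 : ‖iteratedFDeriv ℝ i r 0‖ ≤ ∑ i ∈ Finset.range (j + 1), ‖iteratedFDeriv ℝ i r 0‖ :=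
          Finset.single_le_sum (f := fun i => ‖iteratedFDeriv ℝ i r 0‖)
            (fun i _ => norm_nonneg _) (Finset.mem_range.2 (by omega))
        have h3 : D ≤ D ^ i := le_self_pow₀ hD1 (by omega)
        have h4 : ‖iteratedFDeriv ℝ i r 0‖ ≤ D := by simp only [D]; linarith
        exact h4.trans h3)
    rw [← norm_eq_zero]
    exact le_antisymm (h.trans (by simp)) (norm_nonneg _)
  · have := hrpos x hx
    rw [Function.comp_apply, hφval _ this]
    exact inv_pos.2 (expSer_pos hb1 hbpos (inv_pos.2 this).le)
  · rw [iteratedFDeriv_tsum hu hv huv le_top]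
    simp only [hueq, (hq _).2 z hz j, smul_zero, tsum_zero]
  · by_cases hz : z.1 = 0
    · have : ∀ N, u N z = 0 := fun N => by simp only [u, (hq N).zero hz, smul_zero]
      simp [this, hflat.zero hz]
    · have hp := hrpos z.1 hz
      have hE := expSer_pos hb1 hbpos (inv_pos.2 hp).le
      rw [Function.comp_apply, hφval _ hp]
      have : ∑' N, u N z = expSer b (r z.1)⁻¹ * f z := by
        rw [expSer, ← tsum_mul_right]
        refine tsum_congr fun N => ?_
        simp only [u, q, a, smul_eq_mul]
        ring
      beta_reduce
      rw [this, inv_mul_cancel_left₀ hE.ne']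
end

section
/- Let (f_k)_{k ∈ ℕ} be a sequence of functions ℝ → ℝ, each rapidly decaying on [1, ∞), i.e. for every k and every m ∈ ℕ, t^m f_k(t) → 0 as t → ∞. Then there exists a smooth function g : ℝ → ℝ with g(t) > 0 for all t ≥ 1, such that for every m, j ∈ ℕ, t^m g^{(j)}(t) → 0 as t → ∞, and such that for every k, f_k(t)/g(t) → 0 as t → ∞. -/
open Filter

lemma aux_seq (f : ℕ → ℝ → ℝ)
    (hdecay : ∀ k : ℕ, ∀ m : ℕ, Tendsto (fun t : ℝ => t ^ m * f k t) atTop (nhds 0)) :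
    ∃ a : ℕ → ℝ, (∀ n, 0 < a n) ∧ (∀ m : ℕ, Summable fun n : ℕ => a n * ((n : ℝ) + 1) ^ m) ∧
      ∀ k, ∀ᶠ t : ℝ in atTop, |f k t| * (t + 1) ≤ a ⌊t⌋₊ * 2 := by
  classical
  have h1 : ∀ m : ℕ, ∃ T : ℝ, ∀ t ≥ T, ∀ k ∈ Finset.range (m + 1),
      |f k t| * (t + 1) ^ (m + 1) ≤ 1 := by
    intro m
    rw [← eventually_atTop, eventually_all_finset]
    intro k _
    have h2 : Tendsto (fun t : ℝ => 2 ^ (m + 1) * |t ^ (m + 1) * f k t|) atTop (nhds 0) := by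
      simpa using (hdecay k (m + 1)).abs.const_mul (2 ^ (m + 1))
    filter_upwards [h2.eventually (eventually_le_nhds (zero_lt_one)), eventually_ge_atTop (1 : ℝ)]
      with t ht ht1
    refine le_trans ?_ ht
    rw [abs_mul, abs_of_nonneg (by positivity : (0 : ℝ) ≤ t ^ (m + 1)), ← mul_assoc, ← mul_pow,
      mul_comm]
    gcongr
    linarith
  choose T hT using h1
  let p : ℕ → ℕ := fun n => Nat.findGreatest (fun m => T m ≤ n) n
  have hp : ∀ m : ℕ, ∀ᶠ n : ℕ in atTop, m ≤ p n ∧ T (p n) ≤ n := by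
    intro m
    filter_upwards [eventually_ge_atTop m, eventually_ge_atTop ⌈T m⌉₊] with n hn1 hn2
    have h3 : T m ≤ n := Nat.ceil_le.1 hn2
    exact ⟨Nat.le_findGreatest hn1 h3,
      Nat.findGreatest_spec (P := fun m => T m ≤ (n : ℝ)) hn1 h3⟩
  refine ⟨fun n => (((n : ℝ) + 1) ^ (p n))⁻¹, fun n => by positivity, ?_, ?_⟩
  · intro m
    have h4 : Summable fun n : ℕ => (((n : ℝ) + 1) ^ 2)⁻¹ := by
      have := (summable_nat_add_iff 1).2 (Real.summable_nat_pow_inv.2 (one_lt_two))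
      simpa using this
    refine Summable.of_norm_bounded_eventually_nat h4 ?_
    filter_upwards [hp (m + 2)] with n hn
    rw [Real.norm_of_nonneg (by positivity), inv_mul_le_iff₀ (by positivity),
      ← div_eq_mul_inv, le_div_iff₀ (by positivity), ← pow_add]
    exact pow_le_pow_right₀ (by linarith [Nat.cast_nonneg (α := ℝ) n]) hn.1
  · intro k
    filter_upwards [(tendsto_nat_floor_atTop (α := ℝ)).eventually (hp k),
      eventually_ge_atTop (0 : ℝ)] with t ht ht0
    have h5 := hT (p ⌊t⌋₊) t (ht.2.trans (Nat.floor_le ht0)) k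
      (Finset.mem_range.2 (by have := ht.1; omega))
    have h6 : ((⌊t⌋₊ : ℝ) + 1) ^ p ⌊t⌋₊ ≤ (t + 1) ^ p ⌊t⌋₊ := by
      gcongr
      exact Nat.floor_le ht0
    rw [le_inv_mul_iff₀ (by positivity)]
    calc _ ≤ (t + 1) ^ p ⌊t⌋₊ * (|f k t| * (t + 1)) := by gcongr
      _ = |f k t| * (t + 1) ^ (p ⌊t⌋₊ + 1) := by ring
      _ ≤ 2 := by linarith

lemma aux_bump : ∃ φ : SchwartzMap ℝ ℝ, (∀ x, 0 ≤ φ x) ∧ ∀ x, |x| ≤ 1 → φ x = 1 := by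
  let b : ContDiffBump (0 : ℝ) := ⟨1, 2, one_pos, one_lt_two⟩
  refine ⟨b.hasCompactSupport.toSchwartzMap b.contDiff, fun x => b.nonneg, fun x hx => ?_⟩
  exact b.one_of_mem_closedBall (by simpa [b] using hx)

/-- Common Schwartz envelope for a sequence of rapidly decaying functions on `[1, ∞)`:
there is a positive Schwartz function `g` dominating every `f k` at infinity. -/
theorem stmt13 (f : ℕ → ℝ → ℝ)
    (hdecay : ∀ k : ℕ, ∀ m : ℕ, Tendsto (fun t : ℝ => t ^ m * f k t) atTop (nhds 0)) :
    ∃ g : ℝ → ℝ,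
      ContDiff ℝ (⊤ : ℕ∞) g ∧
      (∀ t : ℝ, 1 ≤ t → 0 < g t) ∧
      (∀ m j : ℕ, Tendsto (fun t : ℝ => t ^ m * iteratedDeriv j g t) atTop (nhds 0)) ∧
      (∀ k : ℕ, Tendsto (fun t : ℝ => f k t / g t) atTop (nhds 0)) := by
  obtain ⟨a, ha, hsum, hfa⟩ := aux_seq f hdecay
  obtain ⟨φ, hφ0, hφ1⟩ := aux_bump
  let F : ℕ → ℝ → ℝ := fun i t => a i * φ (t - i)
  have hF : ∀ i, ContDiff ℝ (⊤ : ℕ∞) (F i) := fun i =>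
    contDiff_const.mul ((φ.smooth _).comp (contDiff_id.sub contDiff_const))
  have hb : ∀ m j : ℕ, ∃ C : ℝ, ∀ (i : ℕ) (t : ℝ),
      |t| ^ m * ‖iteratedFDeriv ℝ j (F i) t‖ ≤ a i * ((i : ℝ) + 1) ^ m * C := by
    intro m j
    obtain ⟨K, hK⟩ : ∃ K : ℝ, ∀ x, (1 + ‖x‖) ^ m * ‖iteratedFDeriv ℝ j φ x‖ ≤ K :=
      ⟨_, SchwartzMap.one_add_le_sup_seminorm_apply (𝕜 := ℝ) (m := (m, j)) le_rfl le_rfl φ⟩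
    refine ⟨K, fun i t => ?_⟩
    · have h1 := hK (t - i)
      rw [norm_iteratedFDeriv_eq_norm_iteratedDeriv] at h1 ⊢
      have h2 : iteratedDeriv j (F i) t = a i * iteratedDeriv j φ (t - i) := by
        have := congrFun (iteratedDeriv_comp_sub_const j (φ : ℝ → ℝ) (i : ℝ)) t
        simp only [F]
        rw [iteratedDeriv_const_mul_field, this]
      rw [h2, norm_mul, Real.norm_of_nonneg (ha i).le]
      have h3 : |t| ≤ ((i : ℝ) + 1) * (1 + ‖t - i‖) := by
        have hi : (0 : ℝ) ≤ i := Nat.cast_nonneg i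
        have h4 : |t| ≤ |t - i| + i := by
          have := abs_add_le (t - i) (i : ℝ)
          rwa [sub_add_cancel, abs_of_nonneg hi] at this
        rw [Real.norm_eq_abs]
        nlinarith [mul_nonneg hi (abs_nonneg (t - i))]
      calc |t| ^ m * (a i * ‖iteratedDeriv j φ (t - i)‖)
          ≤ (((i : ℝ) + 1) * (1 + ‖t - i‖)) ^ m * (a i * ‖iteratedDeriv j φ (t - i)‖) := by
            have := (ha i).le
            gcongr
        _ = a i * ((i : ℝ) + 1) ^ m * ((1 + ‖t - i‖) ^ m * ‖iteratedDeriv j φ (t - i)‖) := by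
            rw [mul_pow]; ring
        _ ≤ _ := by
            have := (ha i).le
            exact mul_le_mul_of_nonneg_left h1 (by positivity)
  choose C hC using hb
  have hv : ∀ j : ℕ, (j : ℕ∞) ≤ (⊤ : ℕ∞) →
      Summable (fun i : ℕ => a i * ((i : ℝ) + 1) ^ 0 * C 0 j) := fun j _ => (hsum 0).mul_right _
  have hFb : ∀ (j i : ℕ) (t : ℝ), (j : ℕ∞) ≤ (⊤ : ℕ∞) →
      ‖iteratedFDeriv ℝ j (F i) t‖ ≤ a i * ((i : ℝ) + 1) ^ 0 * C 0 j := by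
    intro j i t _
    simpa using hC 0 j i t
  have hFs : ∀ t, Summable fun i => F i t := fun t =>
    Summable.of_norm_bounded (hv 0 le_top) fun i => by simpa using hFb 0 i t le_top
  have hF0 : ∀ i t, 0 ≤ F i t := fun i t => mul_nonneg (ha i).le (hφ0 _)
  have hge : ∀ t : ℝ, 0 ≤ t → a ⌊t⌋₊ ≤ ∑' i, F i t := by
    intro t ht
    have h1 : F ⌊t⌋₊ t = a ⌊t⌋₊ := by
      simp only [F]
      rw [hφ1, mul_one]
      rw [abs_le]
      constructor <;> linarith [Nat.floor_le ht, Nat.lt_floor_add_one t]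
    rw [← h1]
    exact (hFs t).le_tsum _ fun i _ => hF0 i t
  refine ⟨fun t => ∑' i, F i t, contDiff_tsum hF hv hFb, ?_, ?_, ?_⟩
  · intro t ht
    exact (ha _).trans_le (hge t (by linarith))
  · intro m j
    have hS := (hsum (m + 1)).mul_right (C (m + 1) j)
    have key : ∀ t : ℝ, |t| ^ (m + 1) * |iteratedDeriv j (fun t => ∑' i, F i t) t| ≤
        ∑' i : ℕ, a i * ((i : ℝ) + 1) ^ (m + 1) * C (m + 1) j := by
      intro t
      rw [← Real.norm_eq_abs (iteratedDeriv _ _ _), ← norm_iteratedFDeriv_eq_norm_iteratedDeriv,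
        iteratedFDeriv_tsum_apply hF hv hFb le_top]
      have hn : Summable fun i => ‖iteratedFDeriv ℝ j (F i) t‖ :=
        Summable.of_nonneg_of_le (fun _ => norm_nonneg _) (fun i => hFb j i t le_top) (hv j le_top)
      calc _ ≤ |t| ^ (m + 1) * ∑' i, ‖iteratedFDeriv ℝ j (F i) t‖ := by
            gcongr
            exact norm_tsum_le_tsum_norm hn
        _ = ∑' i, |t| ^ (m + 1) * ‖iteratedFDeriv ℝ j (F i) t‖ := by rw [tsum_mul_left]
        _ ≤ _ := (hn.mul_left _).tsum_le_tsum (fun i => hC (m + 1) j i t) hS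
    refine squeeze_zero_norm' (a := fun t : ℝ =>
      (∑' i : ℕ, a i * ((i : ℝ) + 1) ^ (m + 1) * C (m + 1) j) / t) ?_
      (tendsto_const_nhds.div_atTop tendsto_id)
    filter_upwards [eventually_gt_atTop (0 : ℝ)] with t ht
    rw [le_div_iff₀ ht, norm_mul, norm_pow, Real.norm_eq_abs, Real.norm_eq_abs]
    refine le_trans (le_of_eq ?_) (key t)
    rw [abs_of_pos ht]
    ring
  · intro k
    refine squeeze_zero_norm' (a := fun t : ℝ => 2 / (t + 1)) ?_
      (tendsto_const_nhds.div_atTop (tendsto_atTop_add_const_right _ _ tendsto_id))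
    filter_upwards [hfa k, eventually_ge_atTop (0 : ℝ)] with t ht ht0
    have hg := (ha _).trans_le (hge t ht0)
    rw [norm_div, Real.norm_eq_abs, Real.norm_of_nonneg hg.le,
      div_le_div_iff₀ hg (by linarith)]
    linarith [hge t ht0]
end

section
/- Let f : ℝ → ℝ be smooth on (0, ∞), and define g : ℝ → ℝ by g(t) = f(1/t) for t > 0 and g(t) = 0 for t ≤ 0. Then g is smooth on all of ℝ if and only if for every m, j ∈ ℕ, t^m f^{(j)}(t) → 0 as t → ∞, where f^{(j)} denotes the j-th derivative of f (taken on (0, ∞)). -/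
open Filter

/-- Auxiliary: the inversion of a weighted function. -/
noncomputable def invW (F : ℕ → ℝ → ℝ) (m j : ℕ) (t : ℝ) : ℝ :=
  if 0 < t then (t⁻¹) ^ m * F j (t⁻¹) else 0

lemma invW_hasDerivAt (F : ℕ → ℝ → ℝ)
    (hF : ∀ j t, 0 < t → HasDerivAt (F j) (F (j + 1) t) t)
    (hd : ∀ m j : ℕ, Tendsto (fun t : ℝ => t ^ m * F j t) atTop (nhds 0)) (m j : ℕ) (t : ℝ) :
    HasDerivAt (invW F m j) (-(m : ℝ) * invW F (m + 1) j t - invW F (m + 2) (j + 1) t) t := by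
  rcases lt_trichotomy t 0 with ht | rfl | ht
  · have h0 : ∀ m j, invW F m j t = 0 := fun m j => by simp [invW, not_lt.2 ht.le]
    rw [h0, h0]
    have : invW F m j =ᶠ[nhds t] fun _ => (0 : ℝ) := by
      filter_upwards [Iio_mem_nhds ht] with s hs
      simp [invW, not_lt.2 (le_of_lt (Set.mem_Iio.1 hs))]
    simpa using (hasDerivAt_const t (0 : ℝ)).congr_of_eventuallyEq this
  · have h0 : ∀ m j, invW F m j 0 = 0 := fun m j => by simp [invW]
    rw [h0, h0, hasDerivAt_iff_tendsto_slope, ← Set.Iio_union_Ioi, nhdsWithin_union]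
    simp only [mul_zero, sub_zero]
    refine Tendsto.sup ?_ ?_
    · refine Tendsto.congr' ?_ tendsto_const_nhds
      filter_upwards [self_mem_nhdsWithin] with s hs
      simp [slope, invW, not_lt.2 (le_of_lt (Set.mem_Iio.1 hs))]
    · refine Tendsto.congr' ?_ ((hd (m + 1) j).comp tendsto_inv_nhdsGT_zero)
      filter_upwards [self_mem_nhdsWithin] with s hs
      have hs' : 0 < s := hs
      simp [slope, invW, hs']
      ring
  · have : invW F m j =ᶠ[nhds t] fun t => (t⁻¹) ^ m * F j (t⁻¹) := by
      filter_upwards [Ioi_mem_nhds ht] with s hs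
      have hs' : 0 < s := hs
      simp [invW, hs']
    refine HasDerivAt.congr_of_eventuallyEq ?_ this
    have h1 := hasDerivAt_inv ht.ne'
    have h2 := (h1.pow m).mul ((hF j t⁻¹ (inv_pos.2 ht)).comp t h1)
    refine h2.congr_deriv ?_
    simp only [invW, if_pos ht, Function.comp, Pi.pow_apply]
    rcases m with _ | m
    · simp; ring
    · simp; ring

lemma invW_contDiff (F : ℕ → ℝ → ℝ)
    (hF : ∀ j t, 0 < t → HasDerivAt (F j) (F (j + 1) t) t)
    (hd : ∀ m j : ℕ, Tendsto (fun t : ℝ => t ^ m * F j t) atTop (nhds 0)) (n : ℕ) :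
    ∀ m j : ℕ, ContDiff ℝ n (invW F m j) := by
  induction n with
  | zero =>
    intro m j
    simp only [Nat.cast_zero, contDiff_zero]
    exact continuous_iff_continuousAt.2 fun t => (invW_hasDerivAt F hF hd m j t).continuousAt
  | succ n ih =>
    intro m j
    push_cast
    rw [contDiff_succ_iff_deriv]
    refine ⟨fun t => (invW_hasDerivAt F hF hd m j t).differentiableAt, by simp, ?_⟩
    rw [show deriv (invW F m j) = fun t => -(m : ℝ) * invW F (m + 1) j t
      - invW F (m + 2) (j + 1) t from funext fun t => (invW_hasDerivAt F hF hd m j t).deriv]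
    exact (contDiff_const.mul (ih _ _)).sub (ih _ _)

lemma deriv_flat (g : ℝ → ℝ) (hg : ContDiff ℝ (⊤ : ℕ∞) g) (h0 : ∀ t ≤ 0, g t = 0) :
    ContDiff ℝ (⊤ : ℕ∞) (deriv g) ∧ ∀ t ≤ 0, deriv g t = 0 := by
  have hd : ContDiff ℝ (⊤ : ℕ∞) (deriv g) := (contDiff_infty_iff_deriv.1 hg).2
  refine ⟨hd, fun t ht => ?_⟩
  have hc : IsClosed {t | deriv g t = 0} := isClosed_eq hd.continuous continuous_const
  have hs : Set.Iio (0 : ℝ) ⊆ {t | deriv g t = 0} := by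
    intro s hs
    have : g =ᶠ[nhds s] fun _ => (0 : ℝ) := by
      filter_upwards [Iio_mem_nhds hs] with u hu
      exact h0 u (le_of_lt hu)
    simp [this.deriv_eq]
  have := hc.closure_subset_iff.2 hs
  rw [closure_Iio] at this
  exact this ht

lemma flat_bound (m : ℕ) : ∀ g : ℝ → ℝ, ContDiff ℝ (⊤ : ℕ∞) g → (∀ t ≤ 0, g t = 0) →
    ∃ C : ℝ, ∀ t ∈ Set.Icc (0 : ℝ) 1, |g t| ≤ C * t ^ m := by
  induction m with
  | zero =>
    intro g hg _
    obtain ⟨C, hC⟩ := isCompact_Icc.exists_bound_of_continuousOn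
      (s := Set.Icc (0 : ℝ) 1) hg.continuous.continuousOn
    exact ⟨C, fun t ht => by simpa using hC t ht⟩
  | succ m ih =>
    intro g hg h0
    obtain ⟨hd, hd0⟩ := deriv_flat g hg h0
    obtain ⟨C, hC⟩ := ih _ hd hd0
    have hCn : 0 ≤ C := by simpa using (abs_nonneg _).trans (hC 1 (by simp))
    refine ⟨C, fun t ht => ?_⟩
    have hdiff : Differentiable ℝ g := hg.differentiable (by simp)
    have := norm_image_sub_le_of_norm_deriv_le_segment' (f := g) (f' := deriv g) (a := 0) (b := t)
      (C := C * t ^ m) (fun x _ => (hdiff x).hasDerivAt.hasDerivWithinAt) (fun x hx => by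
        refine (hC x ⟨hx.1, hx.2.le.trans ht.2⟩).trans ?_
        have := hx.1
        have := hx.2.le
        gcongr) t ⟨ht.1, le_rfl⟩
    rw [h0 0 le_rfl, sub_zero, sub_zero, Real.norm_eq_abs] at this
    rw [pow_succ]
    linarith

lemma flat_decay (j : ℕ) : ∀ f g : ℝ → ℝ, ContDiff ℝ (⊤ : ℕ∞) g → (∀ t ≤ 0, g t = 0) →
    (∀ t, 0 < t → f t = g t⁻¹) → ∀ m : ℕ,
    Tendsto (fun t : ℝ => t ^ m * iteratedDerivWithin j f (Set.Ioi 0) t) atTop (nhds 0) := by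
  induction j with
  | zero =>
    intro f g hg h0 hfg m
    obtain ⟨C, hC⟩ := flat_bound (m + 1) g hg h0
    have hlim : Tendsto (fun t : ℝ => C * t⁻¹) atTop (nhds 0) := by
      simpa using tendsto_inv_atTop_zero.const_mul C
    refine squeeze_zero_norm' ?_ hlim
    filter_upwards [eventually_ge_atTop 1] with t ht
    have htp : 0 < t := by linarith
    rw [iteratedDerivWithin_zero, hfg t htp, norm_mul, Real.norm_eq_abs, Real.norm_eq_abs,
      abs_of_nonneg (by positivity)]
    calc t ^ m * |g t⁻¹| ≤ t ^ m * (C * t⁻¹ ^ (m + 1)) := by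
          gcongr
          exact hC _ ⟨by positivity, inv_le_one_of_one_le₀ ht⟩
      _ = C * t⁻¹ := by
          rw [inv_pow, pow_succ]; field_simp
  | succ j ih =>
    intro f g hg h0 hfg m
    obtain ⟨hd, hd0⟩ := deriv_flat g hg h0
    have hdiff : Differentiable ℝ g := hg.differentiable (by simp)
    have := ih (derivWithin f (Set.Ioi 0)) (fun t => -t ^ 2 * deriv g t)
      ((contDiff_id.pow 2).neg.mul hd) (fun t ht => by simp [hd0 t ht]) (fun t ht => by
        have h1 := (hdiff t⁻¹).hasDerivAt.comp t (hasDerivAt_inv ht.ne')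
        have h2 : HasDerivAt f (deriv g t⁻¹ * -(t ^ 2)⁻¹) t := by
          refine h1.congr_of_eventuallyEq ?_
          filter_upwards [Ioi_mem_nhds ht] with s hs
          exact hfg s hs
        rw [derivWithin_of_isOpen isOpen_Ioi ht, h2.deriv]
        rw [inv_pow]; ring) m
    simpa only [iteratedDerivWithin_succ'] using this

/-- Inversion principle: for `f` smooth on `(0, ∞)`, the function `g` with `g t = f (1/t)`
for `t > 0` and `g t = 0` for `t ≤ 0` is smooth on `ℝ` iff `f` and all its derivatives are
rapidly decaying at infinity (i.e. `f` is Schwartz on `[1, ∞)`). -/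
theorem stmt14 (f : ℝ → ℝ) (hf : ContDiffOn ℝ (⊤ : ℕ∞) f (Set.Ioi 0))
    (g : ℝ → ℝ) (hg : ∀ t : ℝ, g t = if 0 < t then f (1 / t) else 0) :
    ContDiff ℝ (⊤ : ℕ∞) g ↔
      ∀ m j : ℕ,
        Tendsto (fun t : ℝ => t ^ m * iteratedDerivWithin j f (Set.Ioi 0) t) atTop (nhds 0) := by
  constructor
  · intro h m j
    refine flat_decay j f g h (fun t ht => by simp [hg, not_lt.2 ht]) (fun t ht => ?_) m
    simp [hg, ht]
  · intro h
    have hgi : g = invW (fun j => iteratedDerivWithin j f (Set.Ioi 0)) 0 0 := by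
      funext t
      simp [hg, invW]
    rw [hgi, contDiff_infty]
    intro n
    refine invW_contDiff _ (fun j t ht => ?_) h n 0 0
    have hdi := hf.differentiableOn_iteratedDerivWithin (m := j)
      (by exact_mod_cast WithTop.coe_lt_top _) (uniqueDiffOn_Ioi 0)
    have := ((hdi t ht).differentiableAt (Ioi_mem_nhds ht)).hasDerivAt
    rw [iteratedDerivWithin_succ, derivWithin_of_isOpen isOpen_Ioi ht]
    exact this
end

section
/- Let (f_k)_{k ∈ ℕ} be a sequence of functions [0, ∞) → ℝ, each vanishing to infinite order at 0 in the sense that f_k(0) = 0 and for every m ∈ ℕ, f_k(t) t^{−m} → 0 as t → 0⁺. Then there exists a smooth function g : ℝ → ℝ with g(t) = 0 for all t ≤ 0 and g(t) > 0 for all t > 0, such that for every k, f_k(t)/g(t) → 0 as t → 0⁺. -/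
open Filter

/-- Given a sequence of functions on `[0, ∞)` all vanishing to infinite order at `0`, there is a
smooth function `g`, vanishing on `(-∞, 0]` and positive on `(0, ∞)`, dominating all of them
near `0⁺`. -/
theorem stmt15 (f : ℕ → ℝ → ℝ)
    (hzero : ∀ k : ℕ, f k 0 = 0)
    (hvanish : ∀ k : ℕ, ∀ m : ℕ,
      Tendsto (fun t : ℝ => f k t / t ^ m) (nhdsWithin 0 (Set.Ioi 0)) (nhds 0)) :
    ∃ g : ℝ → ℝ,
      ContDiff ℝ (⊤ : ℕ∞) g ∧
      (∀ t : ℝ, t ≤ 0 → g t = 0) ∧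
      (∀ t : ℝ, 0 < t → 0 < g t) ∧
      (∀ k : ℕ, Tendsto (fun t : ℝ => f k t / g t) (nhdsWithin 0 (Set.Ioi 0)) (nhds 0)) := by
  classical
  let P : ℕ → ℕ → Prop := fun n m => ∀ j ≤ m, ∀ t : ℝ, (1/2:ℝ)^(n+1) < t → t ≤ (1/2:ℝ)^n →
    |f j t| ≤ ((1/2:ℝ)^n)^m / (m+1)
  have hP : ∀ m, ∀ᶠ n in atTop, P n m := by
    intro m
    have h1 : ∀ᶠ t in nhdsWithin (0:ℝ) (Set.Ioi 0), ∀ j ∈ Finset.range (m+1),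
        |f j t / t^m| < 1/(m+1) := by
      rw [eventually_all_finset]
      intro j _
      have h2 := (hvanish j m).abs
      rw [abs_zero] at h2
      exact h2.eventually (gt_mem_nhds (by positivity))
    rw [eventually_nhdsWithin_iff, Metric.eventually_nhds_iff] at h1
    obtain ⟨d, hd, h1⟩ := h1
    have h3 : ∀ᶠ n : ℕ in atTop, (1/2:ℝ)^n < d :=
      (tendsto_pow_atTop_nhds_zero_of_lt_one (by norm_num) (by norm_num)).eventually (gt_mem_nhds hd)
    filter_upwards [h3] with n hn j hj t ht1 ht2
    have ht0 : 0 < t := lt_trans (by positivity) ht1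
    have h4 := h1 (y := t) (by rw [Real.dist_eq, sub_zero, abs_of_pos ht0]; linarith) ht0 j
      (by simp; omega)
    rw [abs_div, abs_of_pos (pow_pos ht0 m), div_lt_iff₀ (pow_pos ht0 m)] at h4
    have h5 : t^m ≤ ((1/2:ℝ)^n)^m := pow_le_pow_left₀ ht0.le ht2 m
    calc |f j t| ≤ 1/(m+1) * t^m := h4.le
      _ ≤ 1/(m+1) * ((1/2:ℝ)^n)^m := by gcongr
      _ = _ := by ring
  let μ : ℕ → ℕ := fun n => Nat.findGreatest (P n) n
  have hμ : ∀ m, ∀ᶠ n in atTop, m ≤ μ n := by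
    intro m
    filter_upwards [hP m, eventually_ge_atTop m] with n hn hm
    exact Nat.le_findGreatest hm hn
  have hPμ : ∀ᶠ n in atTop, P n (μ n) := by
    filter_upwards [hP 0] with n hn
    exact Nat.findGreatest_spec (Nat.zero_le n) hn
  let c : ℕ → ℝ := fun n => ((1/2:ℝ)^n)^(μ n)
  have hc0 : ∀ n, 0 < c n := fun n => by positivity
  have hc : ∀ p : ℕ, ∀ᶠ n in atTop, c n * ((2:ℝ)^n)^p ≤ (1/2:ℝ)^n := by
    intro p
    filter_upwards [hμ (p+1)] with n hn
    have h1 : c n ≤ ((1/2:ℝ)^n)^(p+1) :=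
      pow_le_pow_of_le_one (by positivity) (pow_le_one₀ (by norm_num) (by norm_num)) hn
    calc c n * ((2:ℝ)^n)^p ≤ ((1/2:ℝ)^n)^(p+1) * ((2:ℝ)^n)^p := by gcongr
      _ = ((1/2:ℝ)^n * 2^n)^p * (1/2:ℝ)^n := by ring
      _ = (1/2:ℝ)^n := by rw [← mul_pow]; norm_num
  let ψ : ContDiffBump (3/4:ℝ) := ⟨1/4, 1/2, by norm_num, by norm_num⟩
  have hψ : ContDiff ℝ (⊤ : ℕ∞) ψ := ψ.contDiff
  have hM : ∀ k : ℕ, ∃ M, ∀ x, ‖iteratedFDeriv ℝ k ψ x‖ ≤ M := fun k =>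
    (ψ.hasCompactSupport.iteratedFDeriv (𝕜 := ℝ) k).exists_bound_of_continuous
      (hψ.continuous_iteratedFDeriv (by exact_mod_cast le_top))
  choose M hM using hM
  have hs : Summable (fun n : ℕ => (1/2:ℝ)^n) := summable_geometric_two
  let u : ℕ → ℝ → ℝ := fun n t => c n * ψ ((2:ℝ)^n * t)
  have hu0 : ∀ n t, 0 ≤ u n t := fun n t => mul_nonneg (hc0 n).le ψ.nonneg
  have husum : ∀ t, Summable (fun n => u n t) := by
    intro t
    refine Summable.of_norm_bounded_eventually_nat hs ?_
    filter_upwards [hc 0] with n hn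
    rw [Real.norm_of_nonneg (hu0 n t)]
    have := ψ.le_one (x := (2:ℝ)^n * t)
    have := mul_le_mul_of_nonneg_left this (hc0 n).le
    simp only [pow_zero] at hn
    exact this.trans hn
  have hsmooth : ContDiff ℝ (⊤ : ℕ∞) (fun t => ∑' n, u n t) := by
    refine contDiff_tsum_of_eventually (v := fun k n => M k * (1/2:ℝ)^n) ?_ ?_ ?_
    · intro n
      exact contDiff_const.mul (hψ.comp (contDiff_const.mul contDiff_id))
    · intro k _
      exact hs.mul_left _
    · intro k _
      rw [Nat.cofinite_eq_atTop]
      filter_upwards [hc k] with n hn x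
      have hk : ContDiff ℝ k ψ := ψ.contDiff
      have hk' : ContDiff ℝ k (fun t : ℝ => ψ ((2:ℝ)^n * t)) :=
        hk.comp (contDiff_const.mul contDiff_id)
      have hMx := hM k ((2:ℝ)^n * x)
      rw [norm_iteratedFDeriv_eq_norm_iteratedDeriv] at hMx ⊢
      have e : iteratedDeriv k (u n) x = c n * (((2:ℝ)^n)^k * iteratedDeriv k ψ ((2:ℝ)^n * x)) := by
        have e1 := congrFun (iteratedDeriv_comp_const_mul hk ((2:ℝ)^n)) x
        have e2 := iteratedDeriv_const_mul (c n) (hk'.contDiffAt (x := x))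
        simp only [u]
        rw [e2, e1]
      rw [e, ← mul_assoc, norm_mul, Real.norm_of_nonneg (by have := hc0 n; positivity), mul_comm]
      have : 0 ≤ M k := (norm_nonneg _).trans hMx
      gcongr
  refine ⟨fun t => expNegInvGlue t + ∑' n, u n t, expNegInvGlue.contDiff.add hsmooth, ?_, ?_, ?_⟩
  · intro t ht
    have : ∀ n, u n t = 0 := by
      intro n
      have : ψ ((2:ℝ)^n * t) = 0 := by
        apply ψ.zero_of_le_dist
        have : (2:ℝ)^n * t ≤ 0 := mul_nonpos_of_nonneg_of_nonpos (by positivity) ht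
        rw [Real.dist_eq, abs_of_nonpos (by linarith)]
        change (1/2:ℝ) ≤ _
        linarith
      simp [u, this]
    simp [this, expNegInvGlue.zero_of_nonpos ht]
  · intro t ht
    exact add_pos_of_pos_of_nonneg (expNegInvGlue.pos_of_pos ht) (tsum_nonneg fun n => hu0 n t)
  · intro k
    rw [Metric.tendsto_nhds]
    intro ε hε
    obtain ⟨q, hq⟩ := exists_nat_one_div_lt hε
    obtain ⟨N, hN⟩ := eventually_atTop.1 ((hμ k).and ((hμ q).and hPμ))
    have hev : ∀ᶠ t in nhdsWithin (0:ℝ) (Set.Ioi 0), t < (1/2:ℝ)^N :=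
      mem_nhdsWithin_of_mem_nhds (gt_mem_nhds (by positivity))
    filter_upwards [hev, self_mem_nhdsWithin] with t ht ht0
    have ht0 : 0 < t := ht0
    obtain ⟨n, hn1, hn2⟩ := exists_nat_pow_near_of_lt_one ht0
      (ht.le.trans (pow_le_one₀ (by norm_num) (by norm_num))) (y := (1/2:ℝ)) (by norm_num) (by norm_num)
    have hnN : N ≤ n := by
      have := (pow_lt_pow_iff_right_of_lt_one₀ (by norm_num : (0:ℝ) < 1/2) (by norm_num)).1
        (hn1.trans ht)
      omega
    obtain ⟨h1, h2, h3⟩ := hN n hnN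
    have h4 := h3 k h1 t hn1 hn2
    have h22 : (2:ℝ)^n * (1/2)^n = 1 := by rw [← mul_pow]; norm_num
    have hun : u n t = c n := by
      have : ψ ((2:ℝ)^n * t) = 1 := by
        apply ψ.one_of_mem_closedBall
        rw [Metric.mem_closedBall, Real.dist_eq, abs_le]
        change -(1/4:ℝ) ≤ _ ∧ _ ≤ (1/4:ℝ)
        have a := mul_le_mul_of_nonneg_left hn2 (by positivity : (0:ℝ) ≤ 2^n)
        have b := mul_le_mul_of_nonneg_left hn1.le (by positivity : (0:ℝ) ≤ 2^n)
        rw [pow_succ, ← mul_assoc] at b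
        rw [h22] at a b
        constructor <;> linarith
      simp [u, this]
    have hle : c n ≤ expNegInvGlue t + ∑' n, u n t := by
      have := (husum t).le_tsum n (fun j _ => hu0 j t)
      rw [hun] at this
      have := expNegInvGlue.nonneg t
      linarith
    have hcn := hc0 n
    rw [dist_zero_right, norm_div, Real.norm_eq_abs, Real.norm_of_nonneg (hcn.le.trans hle),
      div_lt_iff₀ (hcn.trans_le hle)]
    have hq' : (1:ℝ)/(μ n + 1) ≤ 1/(q+1) := by gcongr
    calc |f k t| ≤ c n / (μ n + 1) := h4
      _ = 1/((μ n : ℝ)+1) * c n := by ring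
      _ < ε * c n := by gcongr; linarith
      _ ≤ _ := by gcongr
end

section
/- Let n = k + ℓ and identify ℝ^n = ℝ^k × ℝ^ℓ. Let f : ℝ^n → ℝ be a function that is smooth on ℝ^n ∖ ({0} × ℝ^ℓ) and such that for every multi-index γ ∈ ℕ^n, the partial derivative ∂^γ f (defined on ℝ^n ∖ ({0} × ℝ^ℓ)) has limit zero at every point of {0} × ℝ^ℓ. Then the function F : ℝ^n → ℝ equal to f on ℝ^n ∖ ({0} × ℝ^ℓ) and equal to 0 on {0} × ℝ^ℓ is C^∞ on all of ℝ^n and vanishes to infinite order on {0} × ℝ^ℓ. -/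
open Filter

lemma stmt16_key {E G H : Type*} [NormedAddCommGroup E] [NormedSpace ℝ E]
    [NormedAddCommGroup G] [NormedSpace ℝ G] [NormedAddCommGroup H] [NormedSpace ℝ H]
    (g : E × G → H) (g' : E × G → (E × G →L[ℝ] H))
    (h0 : ∀ z : E × G, z.1 = 0 → g z = 0)
    (hd : ∀ z : E × G, z.1 ≠ 0 → HasFDerivAt g (g' z) z)
    (hc : ∀ z : E × G, z.1 = 0 → Tendsto g (nhdsWithin z {w : E × G | w.1 ≠ 0}) (nhds 0))
    (hc' : ∀ z : E × G, z.1 = 0 → Tendsto g' (nhdsWithin z {w : E × G | w.1 ≠ 0}) (nhds 0))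
    (z : E × G) (hz : z.1 = 0) : HasFDerivAt g (0 : E × G →L[ℝ] H) z := by
  rw [hasFDerivAt_iff_isLittleO, Asymptotics.isLittleO_iff]
  intro ε hε
  have h1 := Metric.tendsto_nhdsWithin_nhds.1 (hc' z hz) ε hε
  obtain ⟨δ, hδ, h1⟩ := h1
  filter_upwards [Metric.ball_mem_nhds z hδ] with w hw
  rw [h0 z hz]
  simp only [sub_zero, ContinuousLinearMap.zero_apply]
  by_cases hw0 : w.1 = 0
  · rw [h0 w hw0]; simp; positivity
  have hx : ‖w.1‖ ≤ ‖w - z‖ := by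
    have : (w - z).1 = w.1 := by simp [hz]
    rw [← this]; exact norm_fst_le _
  have hy : ‖w.2 - z.2‖ ≤ ‖w - z‖ := norm_snd_le (w - z)
  have hwz : ‖w - z‖ < δ := by rwa [← dist_eq_norm]
  refine le_trans ?_ (mul_le_mul_of_nonneg_left hx hε.le)
  -- the punctured segment
  let γ : ℝ → E × G := fun t => (t • w.1, w.2)
  have hγd : ∀ t, HasDerivAt γ (w.1, 0) t := by
    intro t
    have h2 : HasDerivAt (fun t : ℝ => t • w.1) w.1 t := by
      simpa using (hasDerivAt_id t).smul_const w.1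
    exact h2.prodMk (hasDerivAt_const t w.2)
  have hγU : ∀ t ∈ Set.Ioc (0 : ℝ) 1, (γ t).1 ≠ 0 := by
    intro t ht
    exact smul_ne_zero ht.1.ne' hw0
  have hbd : ∀ t ∈ Set.Ioc (0 : ℝ) 1, ‖g' (γ t)‖ ≤ ε := by
    intro t ht
    have h3 : dist (γ t) z < δ := by
      rw [dist_eq_norm]
      refine lt_of_le_of_lt ?_ hwz
      rw [Prod.norm_def]
      refine max_le ?_ hy
      simp only [γ, Prod.fst_sub, hz, sub_zero, norm_smul, Real.norm_eq_abs, abs_of_pos ht.1]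
      exact (mul_le_of_le_one_left (norm_nonneg _) ht.2).trans hx
    have := h1 (hγU t ht) h3
    rw [dist_zero_right] at this
    exact this.le
  have hmv : ∀ s ∈ Set.Ioc (0 : ℝ) 1, ‖g (γ 1) - g (γ s)‖ ≤ ε * ‖w.1‖ := by
    intro s hs
    have := (convex_Ioc (0 : ℝ) 1).norm_image_sub_le_of_norm_hasDerivWithin_le
      (f := fun t => g (γ t)) (f' := fun t => g' (γ t) (w.1, 0)) (C := ε * ‖w.1‖)
      (fun t ht => ((hd _ (hγU t ht)).comp_hasDerivAt t (hγd t)).hasDerivWithinAt)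
      (fun t ht => by
        refine (ContinuousLinearMap.le_opNorm _ _).trans ?_
        have : ‖((w.1, 0) : E × G)‖ = ‖w.1‖ := by simp [Prod.norm_def]
        rw [this]
        exact mul_le_mul_of_nonneg_right (hbd t ht) (norm_nonneg _))
      hs (Set.right_mem_Ioc.2 one_pos)
    refine this.trans (mul_le_of_le_one_right (by positivity) ?_)
    rw [Real.norm_eq_abs, abs_le]
    constructor <;> linarith [hs.1, hs.2]
  have hmem : Set.Ioc (0 : ℝ) 1 ∈ nhdsWithin (0 : ℝ) (Set.Ioi 0) :=
    Ioc_mem_nhdsGT one_pos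
  have hγ0 : Tendsto γ (nhdsWithin (0 : ℝ) (Set.Ioi 0))
      (nhdsWithin ((0 : E), w.2) {w : E × G | w.1 ≠ 0}) := by
    refine tendsto_nhdsWithin_iff.2 ⟨?_, ?_⟩
    · have := (hγd 0).continuousAt.tendsto
      simp only [γ, zero_smul] at this
      exact this.mono_left nhdsWithin_le_nhds
    · filter_upwards [hmem] with t ht using hγU t ht
  have hlim := ((hc (0, w.2) rfl).comp hγ0).const_sub (g (γ 1)) |>.norm
  have h5 : γ 1 = w := by simp [γ]
  rw [sub_zero, h5] at hlim
  refine le_of_tendsto hlim ?_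
  filter_upwards [hmem] with t ht
  have := hmv t ht
  rwa [h5] at this

/-- If `f` is smooth away from `{0} × ℝ^ℓ ⊆ ℝ^k × ℝ^ℓ` and all its (iterated) derivatives tend
to zero at every point of `{0} × ℝ^ℓ`, then extending `f` by `0` on `{0} × ℝ^ℓ` gives a `C^∞`
function on all of `ℝ^n` vanishing to infinite order on `{0} × ℝ^ℓ`. -/
theorem stmt16 (k l : ℕ) (f : (Fin k → ℝ) × (Fin l → ℝ) → ℝ)
    (hf : ContDiffOn ℝ (⊤ : ℕ∞) f {z : (Fin k → ℝ) × (Fin l → ℝ) | z.1 ≠ 0})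
    (hlim : ∀ j : ℕ, ∀ z : (Fin k → ℝ) × (Fin l → ℝ), z.1 = 0 →
      Tendsto (iteratedFDerivWithin ℝ j f {w : (Fin k → ℝ) × (Fin l → ℝ) | w.1 ≠ 0})
        (nhdsWithin z {w : (Fin k → ℝ) × (Fin l → ℝ) | w.1 ≠ 0}) (nhds 0))
    (F : (Fin k → ℝ) × (Fin l → ℝ) → ℝ)
    (hF : ∀ z : (Fin k → ℝ) × (Fin l → ℝ), F z = if z.1 = 0 then 0 else f z) :
    ContDiff ℝ (⊤ : ℕ∞) F ∧
      ∀ z : (Fin k → ℝ) × (Fin l → ℝ), z.1 = 0 → ∀ j : ℕ, iteratedFDeriv ℝ j F z = 0 := by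
  classical
  set U : Set ((Fin k → ℝ) × (Fin l → ℝ)) := {w | w.1 ≠ 0} with hU
  have hUo : IsOpen U := isOpen_ne_fun continuous_fst continuous_const
  have hT := hf.ftaylorSeriesWithin hUo.uniqueDiffOn
  let p : (Fin k → ℝ) × (Fin l → ℝ) → FormalMultilinearSeries ℝ ((Fin k → ℝ) × (Fin l → ℝ)) ℝ :=
    fun z j => if z.1 = 0 then 0 else iteratedFDerivWithin ℝ j f U z
  have hpU : ∀ j, ∀ z ∈ U, p z j = iteratedFDerivWithin ℝ j f U z := fun j z hz => if_neg hz
  have hp0 : ∀ j, ∀ z : (Fin k → ℝ) × (Fin l → ℝ), z.1 = 0 → p z j = 0 :=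
    fun j z hz => if_pos hz
  have hlim' : ∀ j, ∀ z : (Fin k → ℝ) × (Fin l → ℝ), z.1 = 0 →
      Tendsto (fun w => p w j) (nhdsWithin z U) (nhds 0) := by
    intro j z hz
    refine (hlim j z hz).congr' ?_
    filter_upwards [self_mem_nhdsWithin] with w hw using (hpU j w hw).symm
  have hdU : ∀ j, ∀ z : (Fin k → ℝ) × (Fin l → ℝ), z.1 ≠ 0 →
      HasFDerivAt (fun w => p w j) (p z (j + 1)).curryLeft z := by
    intro j z hz
    have h1 := (hT.fderivWithin j (by exact_mod_cast ENat.coe_lt_top j) z hz).hasFDerivAt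
      (hUo.mem_nhds hz)
    have h2 : p z (j + 1) = ftaylorSeriesWithin ℝ f U z (j + 1) := hpU (j + 1) z hz
    rw [h2]
    refine h1.congr_of_eventuallyEq ?_
    filter_upwards [hUo.mem_nhds hz] with w hw using hpU j w hw
  have hd : ∀ j, ∀ z : (Fin k → ℝ) × (Fin l → ℝ),
      HasFDerivAt (fun w => p w j) (p z (j + 1)).curryLeft z := by
    intro j z
    by_cases hz : z.1 = 0
    · have h1 := stmt16_key (fun w => p w j) (fun w => (p w (j + 1)).curryLeft)
        (hp0 j) (hdU j) (hlim' j) (fun z hz => by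
          have h3 := hlim' (j + 1) z hz
          rw [tendsto_zero_iff_norm_tendsto_zero] at h3 ⊢
          simpa only [ContinuousMultilinearMap.curryLeft_norm] using h3) z hz
      have h2 : (p z (j + 1)).curryLeft = 0 := by
        rw [hp0 (j + 1) z hz]; rfl
      rw [h2]; exact h1
    · exact hdU j z hz
  have hTF : HasFTaylorSeriesUpTo (⊤ : ℕ∞) F p := by
    refine ⟨?_, fun m _ z => hd m z, fun m _ =>
      continuous_iff_continuousAt.2 fun z => (hd m z).continuousAt⟩
    intro z
    rw [hF z]
    by_cases hz : z.1 = 0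
    · rw [hp0 0 z hz, if_pos hz]; rfl
    · rw [hpU 0 z hz, if_neg hz]; rfl
  refine ⟨hTF.contDiff, fun z hz j => ?_⟩
  rw [← hTF.eq_iteratedFDeriv (by exact_mod_cast le_top) z, hp0 j z hz]
end
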